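/- arXiv:math/0511418 — 3 statements merged into one kernel-verified Lean document; each statement's English description precedes it below -/
import Mathlib

section
/- Let F, G : ℝ × ℝ^{2n} → ℝ be smooth compactly supported time-dependent Hamiltonians with flows φ_F^t, φ_G^t and φ_{F+G}^t. Let S be the closure of {x ∈ ℝ^{2n} : ∃t, G(t,x) ≠ 0} (the spatial support of G). If φ_F^t(y) = y for every t ∈ ℝ and every y ∈ S, then φ_{F+G}^t = φ_F^t ∘ φ_G^t for all t ∈ ℝ. -/
/-- The Hamiltonian vector field of a time-dependent Hamiltonian `H` on
`ℝ^{2n} = ℝ^n × ℝ^n` with coordinates `x = (q, p)`: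
`X_H(t, q, p) = (∂H/∂p (t,q,p), −∂H/∂q (t,q,p))`. -/
noncomputable def hamVF {n : ℕ}
    (H : ℝ × (EuclideanSpace ℝ (Fin n) × EuclideanSpace ℝ (Fin n)) → ℝ)
    (t : ℝ) (x : EuclideanSpace ℝ (Fin n) × EuclideanSpace ℝ (Fin n)) :
    EuclideanSpace ℝ (Fin n) × EuclideanSpace ℝ (Fin n) :=
  (gradient (fun p => H (t, (x.1, p))) x.2, -gradient (fun q => H (t, (q, x.2))) x.1)

/-- The Hamiltonian vector field in terms of the total derivative of the Hamiltonian. -/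
theorem hamVF_eq_fderiv {n : ℕ}
    {H : ℝ × (EuclideanSpace ℝ (Fin n) × EuclideanSpace ℝ (Fin n)) → ℝ}
    (hH : Differentiable ℝ H) (t : ℝ) (x : EuclideanSpace ℝ (Fin n) × EuclideanSpace ℝ (Fin n)) :
    hamVF H t x =
      ((InnerProductSpace.toDual ℝ (EuclideanSpace ℝ (Fin n))).symm
        ((fderiv ℝ H (t, x)).comp ((ContinuousLinearMap.inr ℝ ℝ _).comp
          (ContinuousLinearMap.inr ℝ _ _))),
      -(InnerProductSpace.toDual ℝ (EuclideanSpace ℝ (Fin n))).symm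
        ((fderiv ℝ H (t, x)).comp ((ContinuousLinearMap.inr ℝ ℝ _).comp
          (ContinuousLinearMap.inl ℝ _ _)))) := by
  have hp : HasFDerivAt (fun p => H (t, (x.1, p))) ((fderiv ℝ H (t, x)).comp
      ((ContinuousLinearMap.inr ℝ ℝ _).comp (ContinuousLinearMap.inr ℝ _ _))) x.2 :=
    (hH (t, x)).hasFDerivAt.comp x.2
      ((hasFDerivAt_prodMk_right t x).comp x.2 (hasFDerivAt_prodMk_right x.1 x.2))
  have hq : HasFDerivAt (fun q => H (t, (q, x.2))) ((fderiv ℝ H (t, x)).comp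
      ((ContinuousLinearMap.inr ℝ ℝ _).comp (ContinuousLinearMap.inl ℝ _ _))) x.1 :=
    (hH (t, x)).hasFDerivAt.comp x.1
      ((hasFDerivAt_prodMk_right t x).comp x.1 (hasFDerivAt_prodMk_left x.1 x.2))
  simp only [hamVF, gradient, hp.fderiv, hq.fderiv]

theorem hamVF_add {n : ℕ}
    {F G : ℝ × (EuclideanSpace ℝ (Fin n) × EuclideanSpace ℝ (Fin n)) → ℝ}
    (hF : Differentiable ℝ F) (hG : Differentiable ℝ G)
    (t : ℝ) (x : EuclideanSpace ℝ (Fin n) × EuclideanSpace ℝ (Fin n)) :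
    hamVF (fun p => F p + G p) t x = hamVF F t x + hamVF G t x := by
  rw [hamVF_eq_fderiv (hF.fun_add hG), hamVF_eq_fderiv hF, hamVF_eq_fderiv hG,
    fderiv_fun_add (hF _) (hG _)]
  simp only [ContinuousLinearMap.add_comp, map_add, neg_add, Prod.mk_add_mk]

/-- A compactly supported Hamiltonian has a vector field that is Lipschitz in space, uniformly
in time. -/
theorem exists_lipschitzWith_hamVF {n : ℕ}
    {H : ℝ × (EuclideanSpace ℝ (Fin n) × EuclideanSpace ℝ (Fin n)) → ℝ}
    (hH : ContDiff ℝ 2 H) (hHsupp : HasCompactSupport H) :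
    ∃ K, ∀ t, LipschitzWith K (hamVF H t) := by
  obtain ⟨C, hC⟩ := (hH.fderiv_right (m := 1) (by norm_num)).lipschitzWith_of_hasCompactSupport
    (hHsupp.fderiv ℝ) one_ne_zero
  have hd : Differentiable ℝ H := hH.differentiable two_ne_zero
  have key (A : EuclideanSpace ℝ (Fin n) →L[ℝ]
      ℝ × (EuclideanSpace ℝ (Fin n) × EuclideanSpace ℝ (Fin n))) :
      ∃ K, ∀ t : ℝ, LipschitzWith K
        fun x => (InnerProductSpace.toDual ℝ (EuclideanSpace ℝ (Fin n))).symm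
          ((fderiv ℝ H (t, x)).comp A) :=
    ⟨_, fun t => (InnerProductSpace.toDual ℝ _).symm.lipschitz.comp
      ((A.precomp ℝ).lipschitz.comp (hC.comp (LipschitzWith.prodMk_left t)))⟩
  obtain ⟨K₁, h₁⟩ := key ((ContinuousLinearMap.inr ℝ ℝ _).comp (ContinuousLinearMap.inr ℝ _ _))
  obtain ⟨K₂, h₂⟩ := key ((ContinuousLinearMap.inr ℝ ℝ _).comp (ContinuousLinearMap.inl ℝ _ _))
  refine ⟨max K₁ K₂, fun t => ?_⟩
  rw [funext (hamVF_eq_fderiv hd t)]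
  exact (h₁ t).prodMk (h₂ t).neg

/-- Integral curves of the vector field of a compactly supported Hamiltonian are determined by
their value at one time. -/
theorem hamVF_integralCurve_unique {n : ℕ}
    {H : ℝ × (EuclideanSpace ℝ (Fin n) × EuclideanSpace ℝ (Fin n)) → ℝ}
    (hH : ContDiff ℝ 2 H) (hHsupp : HasCompactSupport H)
    {f g : ℝ → EuclideanSpace ℝ (Fin n) × EuclideanSpace ℝ (Fin n)}
    (hf : ∀ t, HasDerivAt f (hamVF H t (f t)) t) (hg : ∀ t, HasDerivAt g (hamVF H t (g t)) t)
    {t₀ : ℝ} (h₀ : f t₀ = g t₀) : f = g := by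
  obtain ⟨K, hK⟩ := exists_lipschitzWith_hamVF hH hHsupp
  exact ODE_solution_unique_univ (s := fun _ => Set.univ) (fun t => (hK t).lipschitzOnWith)
    (fun t => ⟨hf t, Set.mem_univ _⟩) (fun t => ⟨hg t, Set.mem_univ _⟩) h₀

/-- If the vector field vanishes at `y` at all times, an integral curve that meets `y` is
constant. -/
theorem hamVF_integralCurve_eq_const {n : ℕ}
    {H : ℝ × (EuclideanSpace ℝ (Fin n) × EuclideanSpace ℝ (Fin n)) → ℝ}
    (hH : ContDiff ℝ 2 H) (hHsupp : HasCompactSupport H)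
    {f : ℝ → EuclideanSpace ℝ (Fin n) × EuclideanSpace ℝ (Fin n)}
    (hf : ∀ t, HasDerivAt f (hamVF H t (f t)) t)
    {y : EuclideanSpace ℝ (Fin n) × EuclideanSpace ℝ (Fin n)} (hy : ∀ t, hamVF H t y = 0)
    {t₀ : ℝ} (h₀ : f t₀ = y) (t : ℝ) : f t = y :=
  congrFun (hamVF_integralCurve_unique (g := fun _ => y) hH hHsupp hf
    (fun t => by rw [hy]; exact hasDerivAt_const t y) h₀) t

theorem hamVF_eq_zero_of_notMem_closure {n : ℕ}
    {H : ℝ × (EuclideanSpace ℝ (Fin n) × EuclideanSpace ℝ (Fin n)) → ℝ}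
    (hH : Differentiable ℝ H) {x : EuclideanSpace ℝ (Fin n) × EuclideanSpace ℝ (Fin n)}
    (hx : x ∉ closure {x | ∃ s : ℝ, H (s, x) ≠ 0}) (t : ℝ) : hamVF H t x = 0 := by
  have hnhds : ∀ᶠ z in nhds (t, x), z.2 ∉ closure {x | ∃ s : ℝ, H (s, x) ≠ 0} :=
    (isClosed_closure.isOpen_compl.preimage continuous_snd).mem_nhds hx
  have hzero : H =ᶠ[nhds (t, x)] fun _ => 0 := by
    filter_upwards [hnhds] with z hz
    by_contra h
    exact hz (subset_closure ⟨z.1, h⟩)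
  rw [hamVF_eq_fderiv hH, hzero.fderiv_eq]
  simp

/-- If `φF`, `φG`, `φFG` are the Hamiltonian flows of the smooth
compactly supported Hamiltonians `F`, `G` and `F + G` respectively, and the flow of
`F` fixes pointwise the (spatial) support `S = closure {x | ∃ t, G(t,x) ≠ 0}` of `G`,
then `φ_{F+G}^t = φ_F^t ∘ φ_G^t` for all `t`. -/
theorem flow_of_sum_eq_comp_of_fixes_support {n : ℕ}
    (F G : ℝ × (EuclideanSpace ℝ (Fin n) × EuclideanSpace ℝ (Fin n)) → ℝ)
    (hF : ContDiff ℝ (⊤ : ℕ∞) F) (hFsupp : HasCompactSupport F)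
    (hG : ContDiff ℝ (⊤ : ℕ∞) G) (hGsupp : HasCompactSupport G)
    (φF φG φFG : ℝ → (EuclideanSpace ℝ (Fin n) × EuclideanSpace ℝ (Fin n)) →
      (EuclideanSpace ℝ (Fin n) × EuclideanSpace ℝ (Fin n)))
    (hφF0 : ∀ x, φF 0 x = x)
    (hφFode : ∀ t x, HasDerivAt (fun s => φF s x) (hamVF F t (φF t x)) t)
    (hφG0 : ∀ x, φG 0 x = x)
    (hφGode : ∀ t x, HasDerivAt (fun s => φG s x) (hamVF G t (φG t x)) t)
    (hφFG0 : ∀ x, φFG 0 x = x)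
    (hφFGode : ∀ t x, HasDerivAt (fun s => φFG s x)
      (hamVF (fun p => F p + G p) t (φFG t x)) t)
    (hfix : ∀ t : ℝ, ∀ y ∈ closure {x : EuclideanSpace ℝ (Fin n) × EuclideanSpace ℝ (Fin n) |
      ∃ s : ℝ, G (s, x) ≠ 0}, φF t y = y) :
    ∀ t x, φFG t x = φF t (φG t x) := by
  have hF2 : ContDiff ℝ 2 F := hF.of_le (WithTop.coe_le_coe.2 le_top)
  have hG2 : ContDiff ℝ 2 G := hG.of_le (WithTop.coe_le_coe.2 le_top)
  have hFd : Differentiable ℝ F := hF2.differentiable two_ne_zero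
  have hGd : Differentiable ℝ G := hG2.differentiable two_ne_zero
  set S := closure {x : EuclideanSpace ℝ (Fin n) × EuclideanSpace ℝ (Fin n) |
      ∃ s : ℝ, G (s, x) ≠ 0} with hS
  have hGzero : ∀ y ∉ S, ∀ t, hamVF G t y = 0 := fun y hy =>
    hamVF_eq_zero_of_notMem_closure hGd hy
  have hFzero : ∀ y ∈ S, ∀ t, hamVF F t y = 0 := fun y hy t => by
    have h := hφFode t y
    simp only [hfix _ y hy] at h
    exact h.unique (hasDerivAt_const t y)
  intro t x
  suffices h : ∀ t, HasDerivAt (fun s => φF s (φG s x))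
      (hamVF (fun p => F p + G p) t (φF t (φG t x))) t from
    congrFun (hamVF_integralCurve_unique (hF2.add hG2) (hFsupp.add hGsupp)
      (fun t => hφFGode t x) h (t₀ := 0) (by simp only [hφFG0, hφG0, hφF0])) t
  intro t
  rw [hamVF_add hFd hGd]
  by_cases hx : x ∈ S
  · have hmem : ∀ s, φG s x ∈ S := fun s => by
      by_contra hs
      have := hamVF_integralCurve_eq_const hG2 hGsupp (fun t => hφGode t x)
        (hGzero _ hs) (t₀ := s) rfl 0
      rw [hφG0] at this
      exact hs (this ▸ hx)
    simp only [hfix _ _ (hmem _), hFzero _ (hmem t), zero_add]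
    exact hφGode t x
  · have hconst : ∀ s, φG s x = x := hamVF_integralCurve_eq_const hG2 hGsupp
      (fun t => hφGode t x) (hGzero x hx) (hφG0 x)
    have hnot : φF t x ∉ S := fun hs => by
      have := hamVF_integralCurve_eq_const hF2 hFsupp (fun t => hφFode t x)
        (hFzero _ hs) (t₀ := t) rfl 0
      rw [hφF0] at this
      exact hx (this ▸ hs)
    simp only [hconst, hGzero _ hnot, add_zero]
    exact hφFode t x
end

section
/- Let H : ℝ × ℝ^{2n} → ℝ be a smooth compactly supported time-dependent Hamiltonian with flow φ^t = φ_H^t (starting at time 0). Define the second suspended Hamiltonian F : ℝ × ℝ^{2+2n} → ℝ by F(s; t, τ, x) = t·H(st, x). Then for every (t, τ, x) ∈ ℝ × ℝ × ℝ^{2n}, the curve s ↦ ( t , τ − s·H(st, φ^{st}(x)) , φ^{st}(x) ) solves Hamilton's equations for F (with s as the time variable) and takes the value (t, τ, x) at s = 0. Consequently the time-s Hamiltonian flow of F is Φ^s(t, τ, x) = ( t , τ − s·H(st, φ^{st}(x)) , φ^{st}(x) ). -/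
/-- The Hamiltonian vector field, with time variable `s`, of a Hamiltonian
`F(s; t, τ, x)` on `ℝ^{2+2n}` with coordinates `(t, τ, x)`, `(t, τ)` being a
conjugate symplectic pair: Hamilton's equations read
`dt/ds = ∂F/∂τ`, `dτ/ds = −∂F/∂t`, `dx/ds = X_{F(s,t,τ,·)}(x)`. -/
noncomputable def hamVFSusp {n : ℕ}
    (F : ℝ × (ℝ × ℝ × (EuclideanSpace ℝ (Fin n) × EuclideanSpace ℝ (Fin n))) → ℝ)
    (s : ℝ) (y : ℝ × ℝ × (EuclideanSpace ℝ (Fin n) × EuclideanSpace ℝ (Fin n))) :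
    ℝ × ℝ × (EuclideanSpace ℝ (Fin n) × EuclideanSpace ℝ (Fin n)) :=
  (deriv (fun τ => F (s, (y.1, τ, y.2.2))) y.2.1,
   -deriv (fun t => F (s, (t, y.2.1, y.2.2))) y.1,
   hamVF (fun p => F (p.1, (y.1, y.2.1, p.2))) s y.2.2)


/-- The derivative of `H` along a vector with zero time component, in terms of the partial
gradients of `H`. -/
theorem fderiv_apply_zero_eq_inner_gradient {n : ℕ}
    {H : ℝ × (EuclideanSpace ℝ (Fin n) × EuclideanSpace ℝ (Fin n)) → ℝ}
    (hH : Differentiable ℝ H) (t : ℝ)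
    (x v : EuclideanSpace ℝ (Fin n) × EuclideanSpace ℝ (Fin n)) :
    fderiv ℝ H (t, x) (0, v) =
      inner ℝ (gradient (fun q => H (t, (q, x.2))) x.1) v.1 +
        inner ℝ (gradient (fun p => H (t, (x.1, p))) x.2) v.2 := by
  have hq : HasFDerivAt (fun q => H (t, (q, x.2))) _ x.1 :=
    (hH (t, (x.1, x.2))).hasFDerivAt.comp x.1
      ((hasFDerivAt_const t x.1).prodMk ((hasFDerivAt_id x.1).prodMk (hasFDerivAt_const x.2 x.1)))
  have hp : HasFDerivAt (fun p => H (t, (x.1, p))) _ x.2 :=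
    (hH (t, (x.1, x.2))).hasFDerivAt.comp x.2
      ((hasFDerivAt_const t x.2).prodMk ((hasFDerivAt_const x.1 x.2).prodMk (hasFDerivAt_id x.2)))
  simp only [gradient, InnerProductSpace.toDual_symm_apply, hq.fderiv, hp.fderiv,
    ContinuousLinearMap.comp_apply, ContinuousLinearMap.prod_apply, ← map_add]
  simp

/-- A Hamiltonian is constant to first order along its own Hamiltonian vector field. -/
theorem fderiv_apply_hamVF {n : ℕ}
    {H : ℝ × (EuclideanSpace ℝ (Fin n) × EuclideanSpace ℝ (Fin n)) → ℝ}
    (hH : Differentiable ℝ H) (t : ℝ)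
    (x : EuclideanSpace ℝ (Fin n) × EuclideanSpace ℝ (Fin n)) :
    fderiv ℝ H (t, x) (0, hamVF H t x) = 0 := by
  rw [fderiv_apply_zero_eq_inner_gradient hH, hamVF, inner_neg_right, real_inner_comm]
  exact add_neg_cancel _

/-- The gradient commutes with multiplication by a real constant. -/
theorem gradient_const_mul_of_differentiableAt {E : Type*} [NormedAddCommGroup E]
    [InnerProductSpace ℝ E] [CompleteSpace E] {f : E → ℝ} {x : E}
    (hf : DifferentiableAt ℝ f x) (c : ℝ) :
    gradient (fun y => c * f y) x = c • gradient f x := by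
  simp only [gradient, fderiv_const_mul hf c, map_smul]

/-- Let `φ t` be the Hamiltonian flow (starting at time `0`) of a
smooth compactly supported Hamiltonian `H`, and let `F(s; t, τ, x) = t·H(st, x)` be
the second suspended Hamiltonian on `ℝ^{2+2n}`. Then for every `(t, τ, x)` the curve
`s ↦ (t, τ − s·H(st, φ^{st}(x)), φ^{st}(x))` takes the value `(t, τ, x)` at `s = 0`
and solves Hamilton's equations for `F` (with time `s`); consequently it is the
time-`s` Hamiltonian flow of `F`. -/
theorem flow_of_second_suspension {n : ℕ}
    (H : ℝ × (EuclideanSpace ℝ (Fin n) × EuclideanSpace ℝ (Fin n)) → ℝ)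
    (hH : ContDiff ℝ (⊤ : ℕ∞) H) (hHsupp : HasCompactSupport H)
    (φ : ℝ → (EuclideanSpace ℝ (Fin n) × EuclideanSpace ℝ (Fin n)) →
      (EuclideanSpace ℝ (Fin n) × EuclideanSpace ℝ (Fin n)))
    (hφ0 : ∀ x, φ 0 x = x)
    (hφode : ∀ t x, HasDerivAt (fun u => φ u x) (hamVF H t (φ t x)) t)
    (F : ℝ × (ℝ × ℝ × (EuclideanSpace ℝ (Fin n) × EuclideanSpace ℝ (Fin n))) → ℝ)
    (hF : ∀ s t τ x, F (s, (t, τ, x)) = t * H (s * t, x)) :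
    ∀ (t τ : ℝ) (x : EuclideanSpace ℝ (Fin n) × EuclideanSpace ℝ (Fin n)),
      (fun s : ℝ => ((t : ℝ), (τ - s * H (s * t, φ (s * t) x) : ℝ), φ (s * t) x)) 0
          = (t, τ, x) ∧
      ∀ s : ℝ, HasDerivAt
        (fun s : ℝ => ((t : ℝ), (τ - s * H (s * t, φ (s * t) x) : ℝ), φ (s * t) x))
        (hamVFSusp F s ((t : ℝ), (τ - s * H (s * t, φ (s * t) x) : ℝ), φ (s * t) x)) s := by
  have hd : Differentiable ℝ H := hH.differentiable (by simp)
  intro t τ x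
  refine ⟨by simp [hφ0], fun s => ?_⟩
  set z := φ (s * t) x with hz
  have hst : HasDerivAt (fun s : ℝ => s * t) t s := by
    simpa using (hasDerivAt_id s).mul_const t
  have hφs : HasDerivAt (fun s => φ (s * t) x) (t • hamVF H (s * t) z) s :=
    HasDerivAt.scomp (g₁ := fun u => φ u x) s (hφode (s * t) x) hst
  have hHs : HasDerivAt (fun s => H (s * t, φ (s * t) x)) (t * fderiv ℝ H (s * t, z) (1, 0)) s := by
    have h := (hd (s * t, z)).hasFDerivAt.comp_hasDerivAt s (hst.prodMk hφs)
    have e : ((t, t • hamVF H (s * t) z) :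
        ℝ × (EuclideanSpace ℝ (Fin n) × EuclideanSpace ℝ (Fin n))) =
        t • ((1, 0) + (0, hamVF H (s * t) z)) := by simp
    rw [e, map_smul, map_add, fderiv_apply_hamVF hd, add_zero] at h
    exact h
  have hτ : HasDerivAt (fun s => τ - s * H (s * t, φ (s * t) x))
      (-(H (s * t, z) + t * (s * fderiv ℝ H (s * t, z) (1, 0)))) s := by
    refine (((hasDerivAt_id s).mul hHs).const_sub τ).congr_deriv ?_
    simp only [id, ← hz]
    ring
  have hFt : HasDerivAt (fun t => t * H (s * t, z))
      (H (s * t, z) + t * (s * fderiv ℝ H (s * t, z) (1, 0))) t := by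
    have hs : HasDerivAt (fun t : ℝ => s * t) s t := by
      simpa using (hasDerivAt_id t).const_mul s
    have h := (hd (s * t, z)).hasFDerivAt.comp_hasDerivAt t (hs.prodMk (hasDerivAt_const t z))
    have e : ((s, 0) : ℝ × (EuclideanSpace ℝ (Fin n) × EuclideanSpace ℝ (Fin n))) =
        s • (1, 0) := by simp
    rw [e, map_smul] at h
    refine ((hasDerivAt_id t).mul h).congr_deriv ?_
    simp
  have hvf : hamVFSusp F s (t, τ - s * H (s * t, z), z) =
      (0, -(H (s * t, z) + t * (s * fderiv ℝ H (s * t, z) (1, 0))), t • hamVF H (s * t) z) := by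
    have hq : DifferentiableAt ℝ (fun q => H (s * t, (q, z.2))) z.1 := by fun_prop
    have hp : DifferentiableAt ℝ (fun p => H (s * t, (z.1, p))) z.2 := by fun_prop
    simp only [hamVFSusp, hamVF, hF, hFt.deriv, deriv_const,
      gradient_const_mul_of_differentiableAt hq, gradient_const_mul_of_differentiableAt hp,
      Prod.smul_mk, smul_neg]
  rw [hvf]
  exact (hasDerivAt_const s t).prodMk (hτ.prodMk hφs)
end

section
/- Let ω₀ be the standard symplectic form on ℝ^{2n} = ℝ^n × ℝ^n, given by ω₀((q,p),(q',p')) = ⟨p, q'⟩ − ⟨p', q⟩, let N = ℝ^n × {0} be the zero section (a Lagrangian subspace), and let W ⊆ ℝ^{2n} be a coisotropic linear subspace, i.e. W^ω ⊆ W where W^ω denotes the ω₀-orthogonal complement. Then there exist linear subspaces N₁, V₁, N₂, V₂, N₃, V₃ of ℝ^{2n}, each of them isotropic (contained in its own ω₀-orthogonal complement), such that: ℝ^{2n} is the internal direct sum N₁ ⊕ V₁ ⊕ N₂ ⊕ V₂ ⊕ N₃ ⊕ V₃; N = N₁ ⊕ N₂ ⊕ N₃; each Nᵢ ⊕ Vᵢ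 (i = 1,2,3) is a symplectic subspace (the restriction of ω₀ to it is nondegenerate); and W = N₁ ⊕ V₁ ⊕ N₂ ⊕ V₃. -/
open scoped RealInnerProductSpace

/-- The standard symplectic form on `ℝ^{2n} = ℝ^n × ℝ^n`:
`ω₀((q,p),(q',p')) = ⟨p, q'⟩ − ⟨p', q⟩`. -/
noncomputable def omega0 (n : ℕ) :
    LinearMap.BilinForm ℝ (EuclideanSpace ℝ (Fin n) × EuclideanSpace ℝ (Fin n)) :=
  LinearMap.mk₂ ℝ (fun x y => ⟪x.2, y.1⟫ - ⟪y.2, x.1⟫)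
    (by intro m₁ m₂ nn; simp [inner_add_left, inner_add_right]; ring)
    (by intro c m nn; simp [inner_smul_left, inner_smul_right]; ring)
    (by intro m n₁ n₂; simp [inner_add_left, inner_add_right]; ring)
    (by intro c m nn; simp [inner_smul_left, inner_smul_right]; ring)

section

open LinearMap.BilinForm

variable {n : ℕ}

local notation "E" => EuclideanSpace ℝ (Fin n)

theorem omega0_apply (x y : E × E) : omega0 n x y = ⟪x.2, y.1⟫ - ⟪y.2, x.1⟫ := rfl

/-- The subspace `{(s p, p) : p ∈ C}` of `ℝ^n × ℝ^n`. -/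
noncomputable def graphOver (s : E →ₗ[ℝ] E) (C : Submodule ℝ E) : Submodule ℝ (E × E) :=
  C.map (s.prod LinearMap.id)

theorem mem_graphOver {s : E →ₗ[ℝ] E} {C : Submodule ℝ E} {x : E × E} :
    x ∈ graphOver s C ↔ x.2 ∈ C ∧ x.1 = s x.2 := by
  simp only [graphOver, Submodule.mem_map]
  constructor
  · rintro ⟨p, hp, rfl⟩
    exact ⟨hp, rfl⟩
  · rintro ⟨h, h'⟩
    exact ⟨x.2, h, Prod.ext h'.symm rfl⟩

theorem prod_bot_le_orthogonal (C : Submodule ℝ E) :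
    C.prod (⊥ : Submodule ℝ E) ≤ orthogonal (omega0 n) (C.prod (⊥ : Submodule ℝ E)) := by
  rintro ⟨q, p⟩ ⟨-, hp⟩ ⟨q', p'⟩ ⟨-, hp'⟩
  obtain rfl : p = 0 := hp
  obtain rfl : p' = 0 := hp'
  simp [omega0_apply]

theorem graphOver_le_orthogonal {s : E →ₗ[ℝ] E} {C : Submodule ℝ E}
    (h : ∀ p ∈ C, ∀ p' ∈ C, ⟪p, s p'⟫ = ⟪p', s p⟫) :
    graphOver s C ≤ orthogonal (omega0 n) (graphOver s C) := by
  intro x hx y hy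
  rw [mem_graphOver] at hx hy
  rw [omega0_apply, hx.2, hy.2, h _ hy.1 _ hx.1, sub_self]

theorem prod_bot_sup_graphOver_inf_orthogonal (s : E →ₗ[ℝ] E) (C : Submodule ℝ E) :
    (C.prod (⊥ : Submodule ℝ E) ⊔ graphOver s C) ⊓
      orthogonal (omega0 n) (C.prod (⊥ : Submodule ℝ E) ⊔ graphOver s C) = ⊥ := by
  rw [eq_bot_iff]
  rintro x ⟨hx, hx'⟩
  obtain ⟨⟨q, z⟩, ⟨hq, hz⟩, y, hy, rfl⟩ := Submodule.mem_sup.1 hx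
  obtain rfl : z = 0 := hz
  replace hq : q ∈ C := hq
  obtain ⟨q', p⟩ := y
  rw [mem_graphOver] at hy
  obtain ⟨hp, rfl⟩ : p ∈ C ∧ q' = s p := hy
  have h₁ := hx' (p, 0) (Submodule.mem_sup_left ⟨hp, rfl⟩)
  simp [omega0_apply] at h₁
  subst h₁
  have h₂ := hx' (s q, q) (Submodule.mem_sup_right (mem_graphOver.2 ⟨hq, rfl⟩))
  simp [omega0_apply] at h₂
  simp [h₂]

theorem eq_zero_of_add_eq_zero_of_inner {F : Type*} [NormedAddCommGroup F]
    [InnerProductSpace ℝ F] {a b c : F} (hab : ⟪a, b⟫ = 0) (hac : ⟪a, c⟫ = 0)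
    (hbc : ⟪b, c⟫ = 0) (h : a + b + c = 0) : a = 0 ∧ b = 0 ∧ c = 0 := by
  have ha : a = 0 := by
    have := congrArg (fun x => ⟪a, x⟫) h
    simpa [inner_add_right, hab, hac] using this
  have hb : b = 0 := by
    have := congrArg (fun x => ⟪b, x⟫) h
    simpa [inner_add_right, ha, hbc] using this
  exact ⟨ha, hb, by simpa [ha, hb] using h⟩

theorem iSupIndep_of_sum_eq_zero_imp_eq_zero {ι R M : Type*} [Fintype ι] [Ring R]
    [AddCommGroup M] [Module R M] {p : ι → Submodule R M}
    (h : ∀ v : ι → M, (∀ i, v i ∈ p i) → ∑ i, v i = 0 → ∀ i, v i = 0) : iSupIndep p := by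
  classical
  rw [iSupIndep_iff_finsetSum_eq_zero_imp_eq_zero]
  intro t v hv hsum i hi
  have hw := h (fun j => if j ∈ t then v j else 0)
    (fun j => by split_ifs with hj; exacts [hv j hj, zero_mem _]) (by simpa using hsum) i
  simpa [hi] using hw

theorem iSupIndep_prod_bot_graphOver (s : E →ₗ[ℝ] E) {C₁ C₂ C₃ : Submodule ℝ E}
    (h₁₂ : C₁ ⟂ C₂) (h₁₃ : C₁ ⟂ C₃) (h₂₃ : C₂ ⟂ C₃) :
    iSupIndep ![C₁.prod (⊥ : Submodule ℝ E), graphOver s C₁,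
      C₂.prod (⊥ : Submodule ℝ E), graphOver s C₂,
      C₃.prod (⊥ : Submodule ℝ E), graphOver s C₃] := by
  refine iSupIndep_of_sum_eq_zero_imp_eq_zero fun v hv h => ?_
  obtain ⟨⟨ha₁, hz₁⟩, hb₁, ⟨ha₂, hz₂⟩, hb₂, ⟨ha₃, hz₃⟩, hb₃⟩ :
      v 0 ∈ C₁.prod (⊥ : Submodule ℝ E) ∧ v 1 ∈ graphOver s C₁ ∧
      v 2 ∈ C₂.prod (⊥ : Submodule ℝ E) ∧ v 3 ∈ graphOver s C₂ ∧
      v 4 ∈ C₃.prod (⊥ : Submodule ℝ E) ∧ v 5 ∈ graphOver s C₃ :=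
    ⟨hv 0, hv 1, hv 2, hv 3, hv 4, hv 5⟩
  rw [mem_graphOver] at hb₁ hb₂ hb₃
  replace hz₁ : (v 0).2 = 0 := hz₁
  replace hz₂ : (v 2).2 = 0 := hz₂
  replace hz₃ : (v 4).2 = 0 := hz₃
  rw [Fin.sum_univ_six] at h
  have h_snd : (v 1).2 + (v 3).2 + (v 5).2 = 0 := by
    simpa [hz₁, hz₂, hz₃] using congrArg Prod.snd h
  obtain ⟨h₁, h₃, h₅⟩ := eq_zero_of_add_eq_zero_of_inner
    (Submodule.isOrtho_iff_inner_eq.1 h₁₂ _ hb₁.1 _ hb₂.1)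
    (Submodule.isOrtho_iff_inner_eq.1 h₁₃ _ hb₁.1 _ hb₃.1)
    (Submodule.isOrtho_iff_inner_eq.1 h₂₃ _ hb₂.1 _ hb₃.1) h_snd
  have h_fst : (v 0).1 + (v 2).1 + (v 4).1 = 0 := by
    simpa [hb₁.2, hb₂.2, hb₃.2, h₁, h₃, h₅] using congrArg Prod.fst h
  obtain ⟨h₀, h₂, h₄⟩ := eq_zero_of_add_eq_zero_of_inner
    (Submodule.isOrtho_iff_inner_eq.1 h₁₂ _ ha₁ _ ha₂)
    (Submodule.isOrtho_iff_inner_eq.1 h₁₃ _ ha₁ _ ha₃)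
    (Submodule.isOrtho_iff_inner_eq.1 h₂₃ _ ha₂ _ ha₃) h_fst
  intro i
  fin_cases i
  · exact Prod.ext h₀ hz₁
  · exact Prod.ext (by simp [hb₁.2, h₁]) h₁
  · exact Prod.ext h₂ hz₂
  · exact Prod.ext (by simp [hb₂.2, h₃]) h₃
  · exact Prod.ext h₄ hz₃
  · exact Prod.ext (by simp [hb₃.2, h₅]) h₅

/-- The linear map `s` describing `W` as `{(a + s p, p) : a ∈ A, p ∈ P}`, where `A × 0 = W ∩ N`
and `P` is the projection of `W` to the second factor. -/
theorem exists_linearMap_graph (W : Submodule ℝ (E × E)) :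
    ∃ s : E →ₗ[ℝ] E,
      (∀ p ∈ W.map (LinearMap.snd ℝ E E), (s p, p) ∈ W) ∧
      (∀ p, s p ∈ (W.comap (LinearMap.inl ℝ E E))ᗮ) ∧
      ∀ p ∈ (W.map (LinearMap.snd ℝ E E))ᗮ, s p = 0 := by
  set A := W.comap (LinearMap.inl ℝ E E)
  set P := W.map (LinearMap.snd ℝ E E)
  obtain ⟨g, hg⟩ := ((LinearMap.snd ℝ E E).submoduleMap W).exists_rightInverse_of_surjective
    (LinearMap.range_eq_top.2 (LinearMap.submoduleMap_surjective _ _))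
  have hg' : ∀ p : P, (g p : E × E).2 = p := fun p =>
    congrArg Subtype.val (LinearMap.congr_fun hg p)
  refine ⟨Aᗮ.starProjection.toLinearMap ∘ₗ LinearMap.fst ℝ E E ∘ₗ W.subtype ∘ₗ g ∘ₗ
    P.orthogonalProjectionOnto.toLinearMap, fun p hp => ?_, fun p => ?_, fun p hp => ?_⟩
  · have hP : P.orthogonalProjectionOnto p = ⟨p, hp⟩ :=
      Submodule.orthogonalProjectionOnto_mem_subspace_eq_self (K := P) ⟨p, hp⟩
    have hA : A.starProjection (g ⟨p, hp⟩ : E × E).1 ∈ A := Submodule.starProjection_apply_mem _ _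
    have h := W.sub_mem (g ⟨p, hp⟩).2 (Submodule.mem_comap.1 hA)
    convert h using 1
    ext1
    · simp [hP, Submodule.starProjection_orthogonal_val]
    · simp [hg']
  · exact Submodule.starProjection_apply_mem _ _
  · have hP : P.orthogonalProjectionOnto p = 0 :=
      Submodule.orthogonalProjectionOnto_apply_of_mem_orthogonal hp
    simp [hP]

end

/-- **Lemma A.3.** Let `N = ℝ^n × {0}` be the zero section and let
`W ⊆ ℝ^{2n}` be a coisotropic linear subspace (`W^ω ⊆ W`).  Then there are isotropic
linear subspaces `N₁, V₁, N₂, V₂, N₃, V₃` such that `ℝ^{2n}` is their internal direct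
sum, `N = N₁ ⊕ N₂ ⊕ N₃`, each `Nᵢ ⊕ Vᵢ` is a symplectic subspace, and
`W = N₁ ⊕ V₁ ⊕ N₂ ⊕ V₃`. -/
theorem coisotropic_decomposition {n : ℕ}
    (W : Submodule ℝ (EuclideanSpace ℝ (Fin n) × EuclideanSpace ℝ (Fin n)))
    (hW : LinearMap.BilinForm.orthogonal (omega0 n) W ≤ W) :
    ∃ N₁ V₁ N₂ V₂ N₃ V₃ :
        Submodule ℝ (EuclideanSpace ℝ (Fin n) × EuclideanSpace ℝ (Fin n)),
      N₁ ≤ LinearMap.BilinForm.orthogonal (omega0 n) N₁ ∧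
      V₁ ≤ LinearMap.BilinForm.orthogonal (omega0 n) V₁ ∧
      N₂ ≤ LinearMap.BilinForm.orthogonal (omega0 n) N₂ ∧
      V₂ ≤ LinearMap.BilinForm.orthogonal (omega0 n) V₂ ∧
      N₃ ≤ LinearMap.BilinForm.orthogonal (omega0 n) N₃ ∧
      V₃ ≤ LinearMap.BilinForm.orthogonal (omega0 n) V₃ ∧
      iSupIndep ![N₁, V₁, N₂, V₂, N₃, V₃] ∧
      N₁ ⊔ V₁ ⊔ N₂ ⊔ V₂ ⊔ N₃ ⊔ V₃ = ⊤ ∧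
      (⊤ : Submodule ℝ (EuclideanSpace ℝ (Fin n))).prod
        (⊥ : Submodule ℝ (EuclideanSpace ℝ (Fin n))) = N₁ ⊔ N₂ ⊔ N₃ ∧
      (N₁ ⊔ V₁) ⊓ LinearMap.BilinForm.orthogonal (omega0 n) (N₁ ⊔ V₁) = ⊥ ∧
      (N₂ ⊔ V₂) ⊓ LinearMap.BilinForm.orthogonal (omega0 n) (N₂ ⊔ V₂) = ⊥ ∧
      (N₃ ⊔ V₃) ⊓ LinearMap.BilinForm.orthogonal (omega0 n) (N₃ ⊔ V₃) = ⊥ ∧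
      W = N₁ ⊔ V₁ ⊔ N₂ ⊔ V₃ := by
  obtain ⟨s, hsW, hsA, hsP⟩ := exists_linearMap_graph W
  have hmemA : ∀ a, a ∈ W.comap (LinearMap.inl ℝ (EuclideanSpace ℝ (Fin n))
      (EuclideanSpace ℝ (Fin n))) ↔ (a, 0) ∈ W := fun a => Iff.rfl
  have hmemP : ∀ x ∈ W, x.2 ∈ W.map (LinearMap.snd ℝ (EuclideanSpace ℝ (Fin n))
      (EuclideanSpace ℝ (Fin n))) := fun x hx => ⟨x, hx, rfl⟩
  set A := W.comap (LinearMap.inl ℝ (EuclideanSpace ℝ (Fin n)) (EuclideanSpace ℝ (Fin n)))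
  set P := W.map (LinearMap.snd ℝ (EuclideanSpace ℝ (Fin n)) (EuclideanSpace ℝ (Fin n)))
  have hW_sub : ∀ x ∈ W, x.1 - s x.2 ∈ A := fun x hx => by
    have h := W.sub_mem hx (hsW _ (hmemP x hx))
    rw [hmemA]
    convert h using 1
    ext1 <;> simp
  have hPA : Pᗮ ≤ A := fun q hq => by
    refine hW fun x hx => ?_
    simp [omega0_apply, hq _ (hmemP x hx)]
  have hadj : ∀ p ∈ Aᗮ, (s.adjoint p, p) ∈ W := fun p hp => by
    refine hW fun x hx => ?_
    have h := hp _ (hW_sub x hx)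
    rw [real_inner_comm, inner_sub_right] at h
    rw [omega0_apply, LinearMap.adjoint_inner_right, real_inner_comm]
    linarith
  have hAP : Aᗮ ≤ P := fun p hp => hmemP _ (hadj p hp)
  have hsymm : ∀ p ∈ Aᗮ, ∀ p' ∈ Aᗮ, ⟪p, s p'⟫ = ⟪p', s p⟫ := fun p hp p' hp' => by
    have h := hp _ (hW_sub _ (hadj p' hp'))
    rw [real_inner_comm, inner_sub_right, LinearMap.adjoint_inner_right, real_inner_comm] at h
    linarith
  have hA_dec : ∀ a ∈ A, ∃ b ∈ A ⊓ P, ∃ c ∈ Pᗮ, a = b + c := fun a ha => by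
    have hc := Submodule.sub_starProjection_mem_orthogonal (K := P) a
    refine ⟨P.starProjection a, ⟨?_, Submodule.starProjection_apply_mem _ _⟩, _, hc, by abel⟩
    simpa using A.sub_mem ha (hPA hc)
  have hP_dec : ∀ p ∈ P, ∃ b ∈ A ⊓ P, ∃ c ∈ Aᗮ, p = b + c := fun p hp => by
    have hc := Submodule.sub_starProjection_mem_orthogonal (K := A) p
    refine ⟨A.starProjection p, ⟨Submodule.starProjection_apply_mem _ _, ?_⟩, _, hc, by abel⟩
    simpa using P.sub_mem hp (hAP hc)
  have h_dec : ∀ e, ∃ b ∈ A ⊓ P, ∃ c ∈ Pᗮ, ∃ d ∈ Aᗮ, e = b + c + d := fun e => by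
    obtain ⟨b, hb, c, hc, h⟩ := hA_dec _ (Submodule.starProjection_apply_mem A e)
    exact ⟨b, hb, c, hc, _, Submodule.sub_starProjection_mem_orthogonal (K := A) e, by
      rw [← h]; abel⟩
  refine ⟨(A ⊓ P).prod ⊥, graphOver s (A ⊓ P), Pᗮ.prod ⊥, graphOver s Pᗮ, Aᗮ.prod ⊥,
    graphOver s Aᗮ, prod_bot_le_orthogonal _, graphOver_le_orthogonal ?_,
    prod_bot_le_orthogonal _, graphOver_le_orthogonal ?_,
    prod_bot_le_orthogonal _, graphOver_le_orthogonal hsymm,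
    iSupIndep_prod_bot_graphOver s ?_ ?_ ?_, ?_, ?_,
    prod_bot_sup_graphOver_inf_orthogonal _ _, prod_bot_sup_graphOver_inf_orthogonal _ _,
    prod_bot_sup_graphOver_inf_orthogonal _ _, ?_⟩
  · intro p hp p' hp'
    rw [hsA p' p hp.1, hsA p p' hp'.1]
  · intro p hp p' hp'
    rw [hsP p hp, hsP p' hp', inner_zero_right, inner_zero_right]
  · exact (Submodule.isOrtho_orthogonal_right P).mono_left inf_le_right
  · exact (Submodule.isOrtho_orthogonal_right A).mono_left inf_le_left
  · exact (Submodule.isOrtho_orthogonal_right A).mono_left hPA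
  · rw [eq_top_iff]
    rintro ⟨q, p⟩ -
    obtain ⟨b, hb, c, hc, d, hd, rfl⟩ := h_dec p
    obtain ⟨b', hb', c', hc', d', hd', h⟩ := h_dec (q - s (b + c + d))
    have hx : (q, b + c + d) = (b', 0) + (s b, b) + (c', 0) + (s c, c) + (d', 0) + (s d, d) := by
      rw [sub_eq_iff_eq_add] at h
      ext1
      · simp [h]; abel
      · simp
    rw [hx]
    exact Submodule.add_mem_sup (Submodule.add_mem_sup (Submodule.add_mem_sup
      (Submodule.add_mem_sup (Submodule.add_mem_sup ⟨hb', rfl⟩ (mem_graphOver.2 ⟨hb, rfl⟩))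
        ⟨hc', rfl⟩) (mem_graphOver.2 ⟨hc, rfl⟩)) ⟨hd', rfl⟩) (mem_graphOver.2 ⟨hd, rfl⟩)
  · refine le_antisymm ?_ (sup_le (sup_le ?_ ?_) ?_)
    · rintro ⟨q, p⟩ ⟨-, hp⟩
      obtain rfl : p = 0 := hp
      obtain ⟨b, hb, c, hc, d, hd, rfl⟩ := h_dec q
      have hx : (b + c + d, (0 : EuclideanSpace ℝ (Fin n))) = (b, 0) + (c, 0) + (d, 0) := by simp
      rw [hx]
      exact Submodule.add_mem_sup (Submodule.add_mem_sup ⟨hb, rfl⟩ ⟨hc, rfl⟩) ⟨hd, rfl⟩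
    all_goals exact Submodule.prod_mono le_top le_rfl
  · have h_prod : ∀ C ≤ A, C.prod ⊥ ≤ W := by
      rintro C hC ⟨q, p⟩ ⟨hq, hp⟩
      obtain rfl : p = 0 := hp
      exact hC hq
    have h_graph : ∀ C ≤ P, graphOver s C ≤ W := by
      rintro C hC ⟨q, p⟩ hx
      obtain ⟨hp, rfl⟩ : p ∈ C ∧ q = s p := mem_graphOver.1 hx
      exact hsW p (hC hp)
    refine le_antisymm ?_ (sup_le (sup_le (sup_le (h_prod _ inf_le_left)
      (h_graph _ inf_le_right)) (h_prod _ hPA)) (h_graph _ hAP))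
    rintro ⟨q, p⟩ hx
    obtain ⟨b, hb, c, hc, h⟩ := hA_dec _ (hW_sub _ hx)
    obtain ⟨b', hb', d, hd, rfl⟩ := hP_dec _ (hmemP _ hx)
    have hx' : (q, b' + d) = (b, 0) + (s b', b') + (c, 0) + (s d, d) := by
      rw [sub_eq_iff_eq_add] at h
      ext1
      · simp at h; simp [h]; abel
      · simp
    rw [hx']
    exact Submodule.add_mem_sup (Submodule.add_mem_sup (Submodule.add_mem_sup ⟨hb, rfl⟩
      (mem_graphOver.2 ⟨hb', rfl⟩)) ⟨hc, rfl⟩) (mem_graphOver.2 ⟨hd, rfl⟩)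
end
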